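/- Let 0 → Π₄ → Π₃ → Π₂ → Π₁ → 0 be an exact sequence of modules (in an abelian category) with Π₁ ≅ Π₄, and suppose F is a homological functor (derived functors H_i of a right-exact functor) such that H_i(Π₂) and H_i(Π₃) are finite-dimensional for all i and H_i(Π_j) = 0 for i large. Then H_i(Π₁) is finite-dimensional for all i. -/

import Mathlib

open CategoryTheory

section aux
open Limits Pretriangulated DerivedCategory

variable {C : Type*} [Category* C] [Abelian C]

attribute [local instance] HasDerivedCategory.standard in
lemma aux_triangle {S : ShortComplex C} (hS : S.ShortExact)
    (R₁ : ProjectiveResolution S.X₁) (R₂ : ProjectiveResolution S.X₂)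
    (R₃ : ProjectiveResolution S.X₃) :
    ∃ T : Triangle (HomotopyCategory C (ComplexShape.up ℤ)),
      T ∈ distTriang (HomotopyCategory C (ComplexShape.up ℤ)) ∧
      Nonempty (T.obj₁ ≅ (HomotopyCategory.quotient _ _).obj R₁.cochainComplex) ∧
      Nonempty (T.obj₂ ≅ (HomotopyCategory.quotient _ _).obj R₂.cochainComplex) ∧
      Nonempty (T.obj₃ ≅ (HomotopyCategory.quotient _ _).obj R₃.cochainComplex) := by
  have e : ∀ {X : C} (R : ProjectiveResolution X),
      Nonempty (Qh.obj ((HomotopyCategory.quotient _ _).obj R.cochainComplex) ≅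
        (singleFunctor C 0).obj X) := fun {X} R ↦
    ⟨(quotientCompQhIso C).app _ ≪≫ asIso (Q.map R.π') ≪≫
      ((singleFunctorIsoCompQ C 0).app X).symm⟩
  obtain ⟨e₁⟩ := e R₁
  obtain ⟨e₂⟩ := e R₂
  obtain ⟨e₃⟩ := e R₃
  obtain ⟨f, hf⟩ := (CochainComplex.IsKProjective.Qh_map_bijective R₁.cochainComplex
    ((HomotopyCategory.quotient _ _).obj R₂.cochainComplex)).surjective
      (e₁.hom ≫ (singleFunctor C 0).map S.f ≫ e₂.inv)
  obtain ⟨Z, g, h, hT⟩ := distinguished_cocone_triangle f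
  refine ⟨_, hT, ⟨Iso.refl _⟩, ⟨Iso.refl _⟩, ?_⟩
  have hT' := Qh.map_distinguished _ hT
  let φ := isoTriangleOfIso₁₂ _ _ hT' hS.singleTriangle_distinguished e₁ e₂ (by
    change Qh.map f ≫ e₂.hom = e₁.hom ≫ (singleFunctor C 0).map S.f
    simp [hf])
  let e' : Qh.obj Z ≅ Qh.obj ((HomotopyCategory.quotient _ _).obj R₃.cochainComplex) :=
    Triangle.π₃.mapIso φ ≪≫ e₃.symm
  have hZ : (HomotopyCategory.subcategoryAcyclic C).leftOrthogonal Z :=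
    ObjectProperty.ext_of_isTriangulatedClosed₃ _ _ hT
      (CochainComplex.IsKProjective.leftOrthogonal _)
      (CochainComplex.IsKProjective.leftOrthogonal _)
  have bZ : ∀ Y, Function.Bijective (Qh.map : (Z ⟶ Y) → _) := fun Y ↦
    hZ.map_bijective_of_isTriangulated _ Y
  have bR := CochainComplex.IsKProjective.Qh_map_bijective R₃.cochainComplex
  obtain ⟨u, hu⟩ := (bZ _).surjective e'.hom
  obtain ⟨v, hv⟩ := (bR _).surjective e'.inv
  have huv : u ≫ v = 𝟙 Z := (bZ _).injective (by
    rw [Functor.map_comp, hu, hv, Iso.hom_inv_id, CategoryTheory.Functor.map_id])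
  have hvu : v ≫ u = 𝟙 _ := (bR _).injective (by
    rw [Functor.map_comp, hu, hv, Iso.inv_hom_id, CategoryTheory.Functor.map_id])
  exact ⟨⟨u, v, huv, hvu⟩⟩

variable {D : Type*} [Category* D] [Abelian D]

lemma aux_extend (F : C ⥤ D) [F.Additive] {ι ι' : Type*} {c : ComplexShape ι}
    {c' : ComplexShape ι'} (e : c.Embedding c') (K : HomologicalComplex C c) :
    Nonempty ((F.mapHomologicalComplex c').obj (K.extend e) ≅
      ((F.mapHomologicalComplex c).obj K).extend e) := by
  let α : ∀ o : Option ι, F.obj (HomologicalComplex.extend.X K o) ≅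
      HomologicalComplex.extend.X ((F.mapHomologicalComplex c).obj K) o := fun o ↦
    match o with
    | some x => Iso.refl _
    | none => (F.map_isZero (isZero_zero _)).iso (isZero_zero _)
  have hα : ∀ o o', (α o).hom ≫
      HomologicalComplex.extend.d ((F.mapHomologicalComplex c).obj K) o o' =
      F.map (HomologicalComplex.extend.d K o o') ≫ (α o').hom := by
    intro o o'
    match o, o' with
    | none, _ => exact (F.map_isZero (isZero_zero _)).eq_of_src _ _
    | some i, none => exact (isZero_zero _).eq_of_tgt _ _
    | some i, some j =>
      change 𝟙 (F.obj (K.X i)) ≫ F.map (K.d i j) = F.map (K.d i j) ≫ 𝟙 (F.obj (K.X j))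
      simp
  exact ⟨HomologicalComplex.Hom.isoOfComponents (fun i ↦ α (e.r i)) (fun i j _ ↦ hα _ _)⟩

lemma aux_derived [HasProjectiveResolutions C] (F : C ⥤ D) [F.Additive] {X : C}
    (R : ProjectiveResolution X) (i : ℕ)
    (n : ℤ) (hn : -(i : ℤ) = n) :
    Nonempty ((F.leftDerived i).obj X ≅
      (HomotopyCategory.homologyFunctor D (ComplexShape.up ℤ) n).obj
        ((F.mapHomotopyCategory _).obj
          ((HomotopyCategory.quotient _ _).obj R.cochainComplex))) := by
  obtain ⟨e⟩ := aux_extend F ComplexShape.embeddingDownNat R.complex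
  refine ⟨R.isoLeftDerivedObj F i ≪≫
    (HomologicalComplex.extendHomologyIso _ ComplexShape.embeddingDownNat
      (j := i) (j' := n) (by simpa using hn)).symm ≪≫
    (HomologicalComplex.homologyFunctor D _ n).mapIso e.symm ≪≫
    ((HomotopyCategory.homologyFunctorFactors D (ComplexShape.up ℤ) n).app _).symm ≪≫
    (HomotopyCategory.homologyFunctor D (ComplexShape.up ℤ) n).mapIso
      ((F.mapHomotopyCategoryFactors _).app _).symm⟩

end aux

lemma aux_finite {A : Type} [Ring A] {k : Type} [Field k]
    (F : ModuleCat A ⥤ ModuleCat k) [F.Additive]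
    {S : ShortComplex (ModuleCat A)} (hS : S.ShortExact) (i : ℕ)
    (h₂ : Module.Finite k ((F.leftDerived i).obj S.X₂))
    (h₃ : Module.Finite k ((F.leftDerived (i + 1)).obj S.X₃)) :
    Module.Finite k ((F.leftDerived i).obj S.X₁) := by
  let R₁ := ProjectiveResolution.of S.X₁
  let R₂ := ProjectiveResolution.of S.X₂
  let R₃ := ProjectiveResolution.of S.X₃
  obtain ⟨T, hT, ⟨t₁⟩, ⟨t₂⟩, ⟨t₃⟩⟩ := aux_triangle hS R₁ R₂ R₃
  let G := F.mapHomotopyCategory (ComplexShape.up ℤ)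
  let H := fun n : ℤ ↦ HomotopyCategory.homologyFunctor (ModuleCat k) (ComplexShape.up ℤ) n
  obtain ⟨d₁⟩ := aux_derived F R₁ i (-(i : ℤ)) rfl
  obtain ⟨d₂⟩ := aux_derived F R₂ i (-(i : ℤ)) rfl
  obtain ⟨d₃⟩ := aux_derived F R₃ (i + 1) (-(i : ℤ) - 1) (by push_cast; ring)
  have E := (H 0).homologySequence_exact₁ _ (G.map_distinguished _ hT)
    (-(i : ℤ) - 1) (-(i : ℤ)) (by ring)
  have f₂ : Module.Finite k ((H (-(i : ℤ))).obj (G.obj T.obj₂)) :=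
    Module.Finite.equiv (d₂ ≪≫ (H _).mapIso (G.mapIso t₂.symm)).toLinearEquiv
  have f₃ : Module.Finite k ((H (-(i : ℤ) - 1)).obj (G.obj T.obj₃)) :=
    Module.Finite.equiv (d₃ ≪≫ (H _).mapIso (G.mapIso t₃.symm)).toLinearEquiv
  have n₂ := isNoetherian_of_isNoetherianRing_of_finite k ((H (-(i : ℤ))).obj (G.obj T.obj₂))
  have n₃ := isNoetherian_of_isNoetherianRing_of_finite k ((H (-(i : ℤ) - 1)).obj (G.obj T.obj₃))
  have f₁ : Module.Finite k ((H (-(i : ℤ))).obj (G.obj T.obj₁)) := by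
    have : IsNoetherian k ((H (-(i : ℤ))).obj (G.obj T.obj₁)) :=
      @isNoetherian_of_range_eq_ker _ _ _ _ _ _ _ _ _ _ _ n₃ n₂ _ _ E.moduleCat_range_eq_ker
    infer_instance
  exact Module.Finite.equiv (d₁ ≪≫ (H _).mapIso (G.mapIso t₁.symm)).toLinearEquiv.symm


/-- Let `0 → P₄ → P₃ → P₂ → P₁ → 0` be an exact sequence of modules
with `P₁ ≅ P₄`, and suppose `F` is a homological functor (the derived functors
`H_i = L_iF` of a right-exact functor `F` with values in vector spaces over a field `k`)
such that `H_i(P₂)` and `H_i(P₃)` are finite-dimensional for all `i` and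
`H_i(Π_j) = 0` for `i` large.  Then `H_i(P₁)` is finite-dimensional for all `i`. -/
theorem stmt_16
    (A : Type) [Ring A] (k : Type) [Field k]
    (P₁ P₂ P₃ P₄ : Type)
    [AddCommGroup P₁] [AddCommGroup P₂] [AddCommGroup P₃] [AddCommGroup P₄]
    [Module A P₁] [Module A P₂] [Module A P₃] [Module A P₄]
    (g₁ : P₄ →ₗ[A] P₃) (g₂ : P₃ →ₗ[A] P₂) (g₃ : P₂ →ₗ[A] P₁)
    (hinj : Function.Injective g₁)
    (hex₁ : Function.Exact g₁ g₂) (hex₂ : Function.Exact g₂ g₃)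
    (hsurj : Function.Surjective g₃)
    (e : P₁ ≃ₗ[A] P₄)
    (F : ModuleCat A ⥤ ModuleCat k) [F.Additive] [Limits.PreservesFiniteColimits F]
    (hfin₂ : ∀ i : ℕ, Module.Finite k ((F.leftDerived i).obj (ModuleCat.of A P₂)))
    (hfin₃ : ∀ i : ℕ, Module.Finite k ((F.leftDerived i).obj (ModuleCat.of A P₃)))
    (hvan : ∃ N : ℕ, ∀ i ≥ N,
      Limits.IsZero ((F.leftDerived i).obj (ModuleCat.of A P₁)) ∧
      Limits.IsZero ((F.leftDerived i).obj (ModuleCat.of A P₂)) ∧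
      Limits.IsZero ((F.leftDerived i).obj (ModuleCat.of A P₃)) ∧
      Limits.IsZero ((F.leftDerived i).obj (ModuleCat.of A P₄))) :
    ∀ i : ℕ, Module.Finite k ((F.leftDerived i).obj (ModuleCat.of A P₁)) := by
  obtain ⟨N, hN⟩ := hvan
  let S₁ : ShortComplex (ModuleCat A) := ShortComplex.mk
    (ModuleCat.ofHom (LinearMap.ker g₃).subtype) (ModuleCat.ofHom g₃) (by ext x; exact x.2)
  have hS₁ : S₁.ShortExact :=
    { exact := by
        rw [ShortComplex.moduleCat_exact_iff]
        intro x hx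
        exact ⟨⟨x, hx⟩, rfl⟩
      mono_f := (ModuleCat.mono_iff_injective _).2 Subtype.val_injective
      epi_g := (ModuleCat.epi_iff_surjective _).2 hsurj }
  let q : P₃ →ₗ[A] LinearMap.ker g₃ := g₂.codRestrict _ (fun x ↦ (hex₂ _).2 ⟨x, rfl⟩)
  let S₂ : ShortComplex (ModuleCat A) := ShortComplex.mk
    (ModuleCat.ofHom g₁) (ModuleCat.ofHom q)
    (by
      ext x
      exact (hex₁ _).2 ⟨x, rfl⟩)
  have hS₂ : S₂.ShortExact :=
    { exact := by
        rw [ShortComplex.moduleCat_exact_iff]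
        intro x hx
        exact (hex₁ x).1 (congrArg Subtype.val hx)
      mono_f := (ModuleCat.mono_iff_injective _).2 hinj
      epi_g := (ModuleCat.epi_iff_surjective _).2 (by
        rintro ⟨y, hy⟩
        obtain ⟨x, hx⟩ := (hex₂ y).1 hy
        exact ⟨x, Subtype.ext hx⟩) }
  have step : ∀ i, Module.Finite k ((F.leftDerived (i + 2)).obj (ModuleCat.of A P₁)) →
      Module.Finite k ((F.leftDerived i).obj (ModuleCat.of A P₁)) := by
    intro i hi
    have hK := aux_finite F hS₁ (i + 1) (hfin₂ _) hi
    have h₄ := aux_finite F hS₂ i (hfin₃ _) hK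
    have h₄' : Module.Finite k ((F.leftDerived i).obj (ModuleCat.of A P₄)) := h₄
    exact Module.Finite.equiv
      ((F.leftDerived i).mapIso e.symm.toModuleIso).toLinearEquiv
  have key : ∀ m i, N ≤ i + m →
      Module.Finite k ((F.leftDerived i).obj (ModuleCat.of A P₁)) := by
    intro m
    induction m with
    | zero =>
      intro i hi
      have := ModuleCat.subsingleton_of_isZero (hN i hi).1
      infer_instance
    | succ m ih => exact fun i hi ↦ step i (ih (i + 2) (by omega))
  exact fun i ↦ key N i (by omega)
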